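/- arXiv:2506.12918 — 3 statements merged into one kernel-verified Lean document; each statement's English description precedes it below -/
import Mathlib

section
/- Let K be a finite group, H a normal subgroup of K, and V a finite-dimensional complex representation of K whose restriction to H is irreducible. Let W be an irreducible finite-dimensional complex representation of K on which H acts trivially. Then the tensor product representation V ⊗ W of K is irreducible. -/
open TensorProduct

/-- A representation is irreducible if the space is nonzero and the only
invariant subspaces are `⊥` and `⊤`. -/
def IsIrreducibleRep {G : Type} [Group G] {V : Type} [AddCommMonoid V]
    [Module ℂ V] (ρ : Representation ℂ G V) : Prop :=
  Nontrivial V ∧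
    ∀ p : Submodule ℂ V, (∀ (g : G), ∀ v ∈ p, ρ g v ∈ p) → p = ⊥ ∨ p = ⊤

/-- **Burnside's theorem** on matrix algebras. -/
theorem Subalgebra.eq_top_of_isSimpleModule {k V : Type*} [Field k] [IsAlgClosed k]
    [AddCommGroup V] [Module k V] [FiniteDimensional k V] (S : Subalgebra k (Module.End k V))
    [IsSimpleModule S V] : S = ⊤ := by
  refine Algebra.eq_top_iff.2 fun f ↦ ?_
  let F : Module.End (Module.End S V) V :=
    { toFun := f
      map_add' := f.map_add
      map_smul' := fun g v ↦ by
        obtain ⟨c, rfl⟩ := (IsSimpleModule.algebraMap_end_bijective_of_isAlgClosed k).2 g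
        exact f.map_smul c v }
  obtain ⟨s, hs⟩ := Module.Finite.fg_top (R := k) (M := V)
  obtain ⟨r, hr⟩ := jacobson_density F s
  have hf : f = r := LinearMap.ext_on hs fun v hv ↦ hr v hv
  exact hf ▸ r.2

/-- The subalgebra of endomorphisms of `V` whose action on the left factor of `V ⊗ W`
preserves a given submodule. -/
def Submodule.rTensorStabilizer {k V W : Type*} [CommSemiring k] [AddCommMonoid V] [Module k V]
    [AddCommMonoid W] [Module k W] (p : Submodule k (V ⊗[k] W)) :
    Subalgebra k (Module.End k V) where
  carrier := {f | ∀ x ∈ p, f.rTensor W x ∈ p}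
  mul_mem' hf hg x hx := by
    rw [LinearMap.rTensor_mul]
    exact hf _ (hg x hx)
  add_mem' hf hg x hx := by
    rw [LinearMap.rTensor_add]
    exact p.add_mem (hf x hx) (hg x hx)
  algebraMap_mem' c x hx := by
    rw [Algebra.algebraMap_eq_smul_one, LinearMap.rTensor_smul, Module.End.one_eq_id,
      LinearMap.rTensor_id]
    exact p.smul_mem c hx

/-- If `p` is stable under all endomorphisms of `V`, and `w` is a coordinate of an element of `p`
with respect to a basis of `V`, then `v ⊗ w` lies in `p` for every `v`. -/
theorem Submodule.tmul_equivFinsuppOfBasisLeft_mem {k V W ι : Type*} [Field k] [DecidableEq ι]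
    [AddCommGroup V] [Module k V] [AddCommGroup W] [Module k W] {p : Submodule k (V ⊗[k] W)}
    (hp : p.rTensorStabilizer = ⊤) (b : Module.Basis ι k V) {x : V ⊗[k] W} (hx : x ∈ p)
    (i : ι) (v : V) : v ⊗ₜ[k] TensorProduct.equivFinsuppOfBasisLeft b x i ∈ p := by
  have hmem : (b.coord i).smulRight v ∈ p.rTensorStabilizer := hp ▸ Algebra.mem_top
  have heq : ∀ y : V ⊗[k] W, ((b.coord i).smulRight v).rTensor W y =
      v ⊗ₜ[k] TensorProduct.equivFinsuppOfBasisLeft b y i := fun y ↦ by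
    induction y with
    | zero => simp
    | tmul a w => simp [TensorProduct.smul_tmul]
    | add y z hy hz => simp [hy, hz, TensorProduct.tmul_add]
  exact heq x ▸ hmem x hx

/-- Let `K` be a finite group, `H` a normal subgroup, and `V` a
finite-dimensional complex representation of `K` whose restriction to `H` is
irreducible. If `W` is an irreducible finite-dimensional complex representation
of `K` on which `H` acts trivially, then `V ⊗ W` is an irreducible
representation of `K`. -/
theorem tensor_irreducible_of_res_irreducible (K : Type) [Group K] [Fintype K]
    (H : Subgroup K) [H.Normal]
    (V : Type) [AddCommGroup V] [Module ℂ V] [FiniteDimensional ℂ V]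
    (W : Type) [AddCommGroup W] [Module ℂ W] [FiniteDimensional ℂ W]
    (ρ : Representation ℂ K V) (σ : Representation ℂ K W)
    (hres : IsIrreducibleRep (ρ.comp H.subtype))
    (hW : IsIrreducibleRep σ)
    (htriv : ∀ h ∈ H, ∀ w : W, σ h w = w) :
    IsIrreducibleRep (ρ.tprod σ) := by
  classical
  obtain ⟨hV, hVirr⟩ := hres
  obtain ⟨hWnt, hWirr⟩ := hW
  refine ⟨inferInstance, fun p hp ↦ ?_⟩
  have hH : ∀ h : H, ρ h ∈ p.rTensorStabilizer := fun h x hx ↦ by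
    have hσ : σ h = LinearMap.id := LinearMap.ext (htriv h h.2)
    simpa [LinearMap.rTensor, hσ] using hp h x hx
  have : IsSimpleModule p.rTensorStabilizer V := by
    refine (isSimpleModule_iff _ _).2 { eq_bot_or_eq_top := fun q ↦ ?_ }
    refine (hVirr (q.restrictScalars ℂ) fun h v hv ↦ q.smul_mem ⟨_, hH h⟩ hv).imp ?_ ?_ <;>
      simp
  have htop := p.rTensorStabilizer.eq_top_of_isSimpleModule
  let U : Submodule ℂ W := ⨅ v : V, p.comap (TensorProduct.mk ℂ V W v)
  have hU : ∀ w, w ∈ U ↔ ∀ v : V, v ⊗ₜ[ℂ] w ∈ p := by simp [U]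
  have hUinv : ∀ g, ∀ w ∈ U, σ g w ∈ U := fun g w hw ↦ (hU _).2 fun v ↦ by
    simpa using hp g _ ((hU w).1 hw (ρ g⁻¹ v))
  rcases hWirr U hUinv with hbot | htop'
  · left
    refine (Submodule.eq_bot_iff p).2 fun x hx ↦ ?_
    let b := Module.finBasis ℂ V
    refine (TensorProduct.equivFinsuppOfBasisLeft b).map_eq_zero_iff.1 (Finsupp.ext fun i ↦ ?_)
    have : TensorProduct.equivFinsuppOfBasisLeft b x i ∈ U :=
      (hU _).2 (Submodule.tmul_equivFinsuppOfBasisLeft_mem htop b hx i)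
    simpa [hbot] using this
  · right
    rw [eq_top_iff, ← TensorProduct.span_tmul_eq_top, Submodule.span_le]
    rintro _ ⟨v, w, rfl⟩
    exact (hU w).1 (htop' ▸ Submodule.mem_top) v
end

section
/- Let K be a finite group, H a normal subgroup of K, and V a finite-dimensional complex representation of K whose restriction to H is irreducible. Let W and W' be irreducible finite-dimensional complex representations of K on which H acts trivially. Then the K-representations V ⊗ W and V ⊗ W' are isomorphic if and only if W and W' are isomorphic. -/
open TensorProduct

/-- Two representations of the same group are isomorphic if there is a linear
equivalence intertwining the actions. -/
def RepIso {K : Type} [Group K] {V₁ V₂ : Type} [AddCommMonoid V₁] [Module ℂ V₁]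
    [AddCommMonoid V₂] [Module ℂ V₂] (ρ₁ : Representation ℂ K V₁)
    (ρ₂ : Representation ℂ K V₂) : Prop :=
  ∃ e : V₁ ≃ₗ[ℂ] V₂, ∀ (g : K) (v : V₁), e (ρ₁ g v) = ρ₂ g (e v)

/-- **Schur's lemma**: an endomorphism commuting with an irreducible representation on a
finite-dimensional complex space is a scalar. -/
theorem IsIrreducibleRep.exists_eq_smul {G : Type} [Group G] {V : Type} [AddCommGroup V]
    [Module ℂ V] [FiniteDimensional ℂ V] {ρ : Representation ℂ G V} (hρ : IsIrreducibleRep ρ)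
    (T : V →ₗ[ℂ] V) (hT : ∀ g v, T (ρ g v) = ρ g (T v)) : ∃ c : ℂ, ∀ v, T v = c • v := by
  have := hρ.1
  obtain ⟨c, hc⟩ := Module.End.exists_eigenvalue T
  refine ⟨c, fun v => ?_⟩
  have htop : Module.End.eigenspace T c = ⊤ := by
    refine (hρ.2 _ fun g v hv => ?_).resolve_left hc
    rw [Module.End.mem_eigenspace_iff] at hv ⊢
    rw [hT, hv, map_smul]
  exact Module.End.mem_eigenspace_iff.mp (htop ▸ Submodule.mem_top)

/-- Contractions against functionals on the right factor separate points of a tensor product. -/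
theorem TensorProduct.ext_of_forall_lTensor_dual {V W : Type} [AddCommGroup V] [Module ℂ V]
    [AddCommGroup W] [Module ℂ W] {x y : V ⊗[ℂ] W}
    (h : ∀ φ : W →ₗ[ℂ] ℂ, φ.lTensor V x = φ.lTensor V y) : x = y := by
  let b := Module.Free.chooseBasis ℂ W
  apply (TensorProduct.equivFinsuppOfBasisRight b).injective
  ext i
  have key : ∀ z : V ⊗[ℂ] W, TensorProduct.equivFinsuppOfBasisRight b z i =
      TensorProduct.rid ℂ V ((b.coord i).lTensor V z) := by
    intro z
    induction z with
    | zero => simp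
    | add a b ha hb => simp [ha, hb]
    | tmul v w => simp
  rw [key, key, h]

theorem TensorProduct.tmul_right_injective {V W : Type} [AddCommGroup V] [Module ℂ V]
    [AddCommGroup W] [Module ℂ W] {v : V} (hv : v ≠ 0) :
    Function.Injective fun w : W => v ⊗ₜ[ℂ] w := by
  intro x y hxy
  obtain ⟨ψ, hψ⟩ := Module.Projective.exists_dual_eq_one ℂ hv
  simpa [hψ] using congrArg (fun z => TensorProduct.lid ℂ W (ψ.rTensor W z)) hxy

/-- If `V` is irreducible over `G`, a linear map `V ⊗ W → V ⊗ W'` commuting with the action of `G`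
on the left factor has the form `id ⊗ f`. -/
theorem IsIrreducibleRep.exists_eq_lTensor {G : Type} [Group G] {V W W' : Type}
    [AddCommGroup V] [Module ℂ V] [FiniteDimensional ℂ V] [AddCommGroup W] [Module ℂ W]
    [AddCommGroup W'] [Module ℂ W'] {ρ : Representation ℂ G V} (hρ : IsIrreducibleRep ρ)
    (e : V ⊗[ℂ] W →ₗ[ℂ] V ⊗[ℂ] W')
    (he : ∀ g x, e ((ρ g).rTensor W x) = (ρ g).rTensor W' (e x)) :
    ∃ f : W →ₗ[ℂ] W', e = f.lTensor V := by
  have := hρ.1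
  obtain ⟨v₀, hv₀⟩ := exists_ne (0 : V)
  obtain ⟨ψ, hψ⟩ := Module.Projective.exists_dual_eq_one ℂ hv₀
  let f : W →ₗ[ℂ] W' :=
    (TensorProduct.lid ℂ W').toLinearMap ∘ₗ ψ.rTensor W' ∘ₗ e ∘ₗ TensorProduct.mk ℂ V W v₀
  refine ⟨f, TensorProduct.ext' fun v w => ?_⟩
  refine TensorProduct.ext_of_forall_lTensor_dual fun φ => ?_
  let T : V →ₗ[ℂ] V := (TensorProduct.rid ℂ V).toLinearMap ∘ₗ φ.lTensor V ∘ₗ e ∘ₗ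
    (TensorProduct.mk ℂ V W).flip w
  have contract : ∀ (g : G) (z : V ⊗[ℂ] W'),
      TensorProduct.rid ℂ V (φ.lTensor V ((ρ g).rTensor W' z)) =
        ρ g (TensorProduct.rid ℂ V (φ.lTensor V z)) := by
    intro g z
    induction z with
    | zero => simp
    | add a b ha hb => simp only [map_add, ha, hb]
    | tmul v w => simp
  obtain ⟨c, hc⟩ := hρ.exists_eq_smul T fun g v => by
    have := he g (v ⊗ₜ w)
    rw [LinearMap.rTensor_tmul] at this
    simp only [T, LinearMap.comp_apply, LinearMap.flip_apply, TensorProduct.mk_apply,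
      LinearEquiv.coe_coe, this, contract]
  have swap : ∀ z : V ⊗[ℂ] W', φ (TensorProduct.lid ℂ W' (ψ.rTensor W' z)) =
      ψ (TensorProduct.rid ℂ V (φ.lTensor V z)) := by
    intro z
    induction z with
    | zero => simp
    | add a b ha hb => simp only [map_add, ha, hb]
    | tmul v w => simp [mul_comm]
  have hf : φ (f w) = c := by
    have h : φ (f w) = ψ (T v₀) := swap _
    rw [h, hc, map_smul, hψ, smul_eq_mul, mul_one]
  apply (TensorProduct.rid ℂ V).injective
  have h : TensorProduct.rid ℂ V (φ.lTensor V (e (v ⊗ₜ w))) = T v := rfl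
  rw [h, hc]
  simp [hf]

/-- Let `K` be a finite group, `H` a normal subgroup, and `V` a
finite-dimensional complex representation of `K` whose restriction to `H` is
irreducible. If `W`, `W'` are irreducible finite-dimensional complex
representations of `K` on which `H` acts trivially, then `V ⊗ W ≅ V ⊗ W'` as
`K`-representations if and only if `W ≅ W'`. -/
theorem tensor_iso_iff_iso (K : Type) [Group K] [Fintype K]
    (H : Subgroup K) [H.Normal]
    (V : Type) [AddCommGroup V] [Module ℂ V] [FiniteDimensional ℂ V]
    (W : Type) [AddCommGroup W] [Module ℂ W] [FiniteDimensional ℂ W]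
    (W' : Type) [AddCommGroup W'] [Module ℂ W'] [FiniteDimensional ℂ W']
    (ρ : Representation ℂ K V) (σ : Representation ℂ K W)
    (σ' : Representation ℂ K W')
    (hres : IsIrreducibleRep (ρ.comp H.subtype))
    (hW : IsIrreducibleRep σ) (hW' : IsIrreducibleRep σ')
    (htriv : ∀ h ∈ H, ∀ w : W, σ h w = w)
    (htriv' : ∀ h ∈ H, ∀ w : W', σ' h w = w) :
    RepIso (ρ.tprod σ) (ρ.tprod σ') ↔ RepIso σ σ' := by
  constructor
  · rintro ⟨e, he⟩
    have := hres.1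
    obtain ⟨f, hf⟩ := hres.exists_eq_lTensor e.toLinearMap fun h x => by
      have hx : ∀ x, (ρ.tprod σ) (h : K) x = (ρ h).rTensor W x := fun x => by
        have : σ (h : K) = LinearMap.id := LinearMap.ext (htriv h h.2)
        rw [Representation.tprod_apply, this]; rfl
      have hx' : ∀ x, (ρ.tprod σ') (h : K) x = (ρ h).rTensor W' x := fun x => by
        have : σ' (h : K) = LinearMap.id := LinearMap.ext (htriv' h h.2)
        rw [Representation.tprod_apply, this]; rfl
      have := he h x
      rwa [hx, hx'] at this
    have hef : ∀ v w, e (v ⊗ₜ w) = v ⊗ₜ f w := fun v w => LinearMap.congr_fun hf (v ⊗ₜ w)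
    obtain ⟨v₀, hv₀⟩ := exists_ne (0 : V)
    have hinj : Function.Injective f := fun x y hxy =>
      TensorProduct.tmul_right_injective hv₀ <| e.injective <| by simp only [hef, hxy]
    have hdim : Module.finrank ℂ W = Module.finrank ℂ W' := by
      have h := e.finrank_eq
      rw [Module.finrank_tensorProduct, Module.finrank_tensorProduct] at h
      exact Nat.eq_of_mul_eq_mul_left Module.finrank_pos h
    refine ⟨LinearEquiv.ofInjectiveOfFinrankEq f hinj hdim, fun g w => ?_⟩
    have hg : ρ g v₀ ≠ 0 := fun h => hv₀ <| by
      rw [← ρ.inv_self_apply g v₀, h, map_zero]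
    apply TensorProduct.tmul_right_injective hg
    have := he g (v₀ ⊗ₜ w)
    have hcoe : ∀ w, LinearEquiv.ofInjectiveOfFinrankEq f hinj hdim w = f w := fun _ => rfl
    simpa [Representation.tprod_apply, hef, hcoe] using this
  · rintro ⟨e, he⟩
    refine ⟨e.lTensor V, fun g x => ?_⟩
    induction x with
    | zero => simp
    | add a b ha hb => simp only [map_add, ha, hb]
    | tmul v w => simp [Representation.tprod_apply, he]
end

section
/- Let K be a finite group and H a normal subgroup of K. Let V and V' be finite-dimensional complex representations of K such that dim V = dim V' and such that the restrictions Res_H V and Res_H V' are isomorphic irreducible representations of H. Then there exists a one-dimensional character ψ : K → ℂ× whose restriction to H is trivial, such that V' is isomorphic as a K-representation to V ⊗ ψ. -/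
/-- **Schur's lemma**: an endomorphism commuting with an irreducible finite-dimensional complex
representation is a scalar. -/
theorem IsIrreducibleRep.exists_eq_smul_of_commute {G : Type} [Group G] {V : Type}
    [AddCommGroup V] [Module ℂ V] [FiniteDimensional ℂ V] {ρ : Representation ℂ G V}
    (hρ : IsIrreducibleRep ρ) (f : Module.End ℂ V) (hf : ∀ g v, f (ρ g v) = ρ g (f v)) :
    ∃ c : ℂ, ∀ v, f v = c • v := by
  have := hρ.1
  obtain ⟨c, hc⟩ := Module.End.exists_eigenvalue f
  refine ⟨c, fun v => Module.End.mem_eigenspace_iff.mp ?_⟩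
  have hinv : ∀ g, ∀ v ∈ f.eigenspace c, ρ g v ∈ f.eigenspace c := fun g v hv => by
    rw [Module.End.mem_eigenspace_iff] at hv ⊢
    rw [hf, hv, map_smul]
  rw [(hρ.2 _ hinv).resolve_left hc]
  exact Submodule.mem_top

/-- If an isomorphism of irreducible restrictions to a normal subgroup is given, then each element
of the whole group acts compatibly with it up to a scalar. -/
theorem IsIrreducibleRep.exists_apply_eq_smul {K : Type} [Group K] {H : Subgroup K} [H.Normal]
    {V : Type} [AddCommGroup V] [Module ℂ V] [FiniteDimensional ℂ V]
    {V' : Type} [AddCommGroup V'] [Module ℂ V']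
    {ρ : Representation ℂ K V} {ρ' : Representation ℂ K V'}
    (hirr : IsIrreducibleRep (ρ.comp H.subtype)) (e : V ≃ₗ[ℂ] V')
    (he : ∀ h ∈ H, ∀ v, e (ρ h v) = ρ' h (e v)) (g : K) :
    ∃ c : ℂ, ∀ v, ρ' g (e v) = c • e (ρ g v) := by
  have hcomm : ∀ (h : H) (v : V), ρ g⁻¹ (e.symm (ρ' g (e (ρ h v)))) =
      ρ h (ρ g⁻¹ (e.symm (ρ' g (e v)))) := fun h v => by
    have hconj : ρ' g (e (ρ h v)) = e (ρ (g * h * g⁻¹) (e.symm (ρ' g (e v)))) := by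
      rw [he _ h.2, he _ (‹H.Normal›.conj_mem _ h.2 g), e.apply_symm_apply,
        ← Module.End.mul_apply, ← Module.End.mul_apply, ← map_mul, ← map_mul,
        inv_mul_cancel_right]
    rw [hconj, e.symm_apply_apply, ← Module.End.mul_apply, ← Module.End.mul_apply,
      ← map_mul, ← map_mul]
    congr 2
    group
  obtain ⟨c, hc⟩ := hirr.exists_eq_smul_of_commute
    (ρ g⁻¹ ∘ₗ e.symm.toLinearMap ∘ₗ ρ' g ∘ₗ e.toLinearMap) hcomm
  refine ⟨c, fun v => ?_⟩
  have hv : ρ g⁻¹ (e.symm (ρ' g (e v))) = c • v := hc v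
  rw [← map_smul, ← map_smul, ← hv, Representation.self_inv_apply, e.apply_symm_apply]

/-- Let `K` be a finite group, `H` a normal subgroup, and `V`, `V'`
finite-dimensional complex representations of `K` of the same dimension whose
restrictions to `H` are isomorphic irreducible `H`-representations. Then there
is a character `ψ : K → ℂˣ`, trivial on `H`, such that `V' ≅ V ⊗ ψ` as
`K`-representations, i.e. there is a linear equivalence `e : V ≃ V'` with
`e (ψ g • ρ g v) = ρ' g (e v)` for all `g`, `v`. -/
theorem exists_character_twist (K : Type) [Group K] [Fintype K]
    (H : Subgroup K) [H.Normal]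
    (V : Type) [AddCommGroup V] [Module ℂ V] [FiniteDimensional ℂ V]
    (V' : Type) [AddCommGroup V'] [Module ℂ V'] [FiniteDimensional ℂ V']
    (ρ : Representation ℂ K V) (ρ' : Representation ℂ K V')
    (hdim : Module.finrank ℂ V = Module.finrank ℂ V')
    (hirr : IsIrreducibleRep (ρ.comp H.subtype))
    (hiso : RepIso (ρ.comp H.subtype) (ρ'.comp H.subtype)) :
    ∃ ψ : K →* ℂˣ, (∀ h ∈ H, ψ h = 1) ∧
      ∃ e : V ≃ₗ[ℂ] V', ∀ (g : K) (v : V),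
        e ((ψ g : ℂ) • ρ g v) = ρ' g (e v) := by
  obtain ⟨e, he⟩ := hiso
  have heH : ∀ h ∈ H, ∀ v, e (ρ h v) = ρ' h (e v) := fun h hh => he ⟨h, hh⟩
  choose c hc using hirr.exists_apply_eq_smul e heH
  have := hirr.1
  obtain ⟨v₀, hv₀⟩ := exists_ne (0 : V)
  have c_unique : ∀ g a, (∀ v, ρ' g (e v) = a • e (ρ g v)) → c g = a := fun g a ha => by
    have h := (hc g (ρ g⁻¹ v₀)).symm.trans (ha _)
    rw [Representation.self_inv_apply] at h
    exact smul_left_injective ℂ (e.map_ne_zero_iff.mpr hv₀) h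
  let χ : K →* ℂ :=
    { toFun := c
      map_one' := c_unique 1 1 (by simp)
      map_mul' := fun g k => c_unique _ _ fun v => by
        simp only [map_mul, Module.End.mul_apply, hc, map_smul, smul_smul, mul_comm] }
  refine ⟨χ.toHomUnits, fun h hh => Units.ext ?_, e, fun g v => ?_⟩
  · exact c_unique h 1 fun v => by rw [one_smul, heH h hh]
  · rw [map_smul]
    exact (hc g v).symm
end
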